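/- arXiv:1312.0933 — 2 statements merged into one kernel-verified Lean document; each statement's English description precedes it below -/
import Mathlib

section
/- Let u ∈ ℂ^{d_n} be a unit vector with d_n ≤ Cn^m, and let a have i.i.d. coordinates whose law has bounded density ≤ C on ℂ and satisfies the tail bound P{log|z| > R} = O(R^{-ρ}) with (ρ-1)(1-ε) ≥ m for some ε ∈ (0,1). Then ∫_{ℂ^{d_n}} |log|⟨a,u⟩|| dP_n(a) = O(n^{1-ε}) as n → ∞, with implied constant independent of the unit vector u. -/
open MeasureTheory Real

lemma aux_meas (μ : Measure ℂ) (C : ℝ) (φ : ℂ → ℝ) (hφ : ∀ z, 0 ≤ φ z ∧ φ z ≤ C)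
    (hμ : μ = volume.withDensity fun z => ENNReal.ofReal (φ z)) :
    μ ≤ ENNReal.ofReal C • (volume : Measure ℂ) := by
  rw [hμ, ← withDensity_const]
  exact withDensity_mono (ae_of_all _ fun z => ENNReal.ofReal_le_ofReal (hφ z).2)

lemma aux_slice_le {N : ℕ} (μ : Measure ℂ) [IsProbabilityMeasure μ] (k : Fin N)
    (f : (Fin N → ℂ) → ENNReal) (hf : Measurable f) (B : ENNReal)
    (h : ∀ x, ∫⁻ z, f (Function.update x k z) ∂μ ≤ B) :
    ∫⁻ a, f a ∂(Measure.pi fun _ : Fin N => μ) ≤ B := by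
  have := lintegral_le_of_lmarginal_le (μ := fun _ : Fin N => μ) {k} hf
    (measurable_const (a := B)) (by
      rw [lmarginal_singleton, lmarginal_singleton]
      intro x; simpa using h x)
  simpa using this

lemma aux_slice_ge {N : ℕ} (μ : Measure ℂ) [IsProbabilityMeasure μ] (k : Fin N)
    (f : (Fin N → ℂ) → ENNReal) (hf : Measurable f) (B : ENNReal)
    (h : ∀ x, B ≤ ∫⁻ z, f (Function.update x k z) ∂μ) :
    B ≤ ∫⁻ a, f a ∂(Measure.pi fun _ : Fin N => μ) := by
  have := lintegral_le_of_lmarginal_le (μ := fun _ : Fin N => μ) {k} 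
    (measurable_const (a := B)) hf (by
      rw [lmarginal_singleton, lmarginal_singleton]
      intro x; simpa using h x)
  simpa using this

lemma aux_sum_update {N : ℕ} (u x : Fin N → ℂ) (k : Fin N) (z : ℂ) :
    ∑ j, Function.update x k z j * u j = z * u k + ∑ j ∈ Finset.univ.erase k, x j * u j := by
  rw [← Finset.add_sum_erase _ _ (Finset.mem_univ k)]
  congr 1
  · simp
  · refine Finset.sum_congr rfl fun j hj => ?_
    rw [Function.update_of_ne (Finset.ne_of_mem_erase hj)]

lemma aux_neglog : ∫⁻ z : ℂ, ENNReal.ofReal (log⁺ ‖z‖⁻¹) ≤ ENNReal.ofReal (2 * π) := by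
  rw [← Complex.lintegral_comp_polarCoord_symm]
  calc _ ≤ ∫⁻ p in polarCoord.target, 
        (Set.Ioo (0:ℝ) 1 ×ˢ Set.Ioo (-π) π).indicator (fun _ => (1:ENNReal)) p := by
        refine setLIntegral_mono' polarCoord.open_target.measurableSet fun p hp => ?_
        rw [polarCoord_target] at hp
        have h0 : 0 < p.1 := hp.1
        simp only [smul_eq_mul, Complex.norm_polarCoord_symm, abs_of_pos h0]
        rw [← ENNReal.ofReal_mul h0.le]
        by_cases h1 : p.1 < 1
        · have hmem : p ∈ Set.Ioo (0:ℝ) 1 ×ˢ Set.Ioo (-π) π := ⟨⟨h0, h1⟩, hp.2⟩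
          rw [Set.indicator_of_mem hmem]
          rw [ENNReal.ofReal_le_one]
          have h2 : (1:ℝ) ≤ p.1⁻¹ := (one_le_inv₀ h0).2 h1.le
          rw [posLog_eq_log (by rwa [abs_of_pos (by positivity)])]
          have h3 := log_le_self (show (0:ℝ) ≤ p.1⁻¹ by positivity)
          calc _ ≤ p.1 * p.1⁻¹ := by gcongr
            _ = 1 := by field_simp
        · have : log⁺ p.1⁻¹ = 0 := by
            rw [posLog_eq_zero_iff, abs_of_pos (by positivity)]
            exact inv_le_one_of_one_le₀ (not_lt.1 h1)
          simp [this]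
    _ ≤ ∫⁻ p, (Set.Ioo (0:ℝ) 1 ×ˢ Set.Ioo (-π) π).indicator (fun _ => (1:ENNReal)) p :=
        setLIntegral_le_lintegral _ _
    _ = ENNReal.ofReal (2 * π) := by
        rw [lintegral_indicator (measurableSet_Ioo.prod measurableSet_Ioo)]
        simp only [lintegral_const, one_mul, MeasurableSet.univ, Measure.restrict_apply,
          Set.univ_inter, Measure.volume_eq_prod, Measure.prod_prod, Real.volume_Ioo]
        rw [← ENNReal.ofReal_mul (by norm_num)]
        congr 1
        ring

lemma aux_neglog_mu (μ : Measure ℂ) (C : ℝ) (hC : 0 ≤ C)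
    (hμ : μ ≤ ENNReal.ofReal C • (volume : Measure ℂ)) (w : ℂ) :
    ∫⁻ z : ℂ, ENNReal.ofReal (log⁺ ‖z + w‖⁻¹) ∂μ ≤ ENNReal.ofReal (C * (2 * π)) := by
  calc _ ≤ ∫⁻ z : ℂ, ENNReal.ofReal (log⁺ ‖z + w‖⁻¹) ∂(ENNReal.ofReal C • (volume : Measure ℂ)) :=
        lintegral_mono' hμ le_rfl
    _ = ENNReal.ofReal C * ∫⁻ z : ℂ, ENNReal.ofReal (log⁺ ‖z‖⁻¹) := by
        rw [lintegral_smul_measure, smul_eq_mul,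
          lintegral_add_right_eq_self (fun z : ℂ => ENNReal.ofReal (log⁺ ‖z‖⁻¹)) w]
    _ ≤ _ := by
        rw [ENNReal.ofReal_mul hC]
        gcongr
        exact aux_neglog

lemma aux_tail (μ : Measure ℂ) (ρ Ct R0 : ℝ) (hρ : 1 < ρ)
    (htail : ∀ R ≥ R0, μ {z : ℂ | R < Real.log ‖z‖} ≤ ENNReal.ofReal (Ct * R ^ (-ρ)))
    (S : ℝ) (hS0 : 0 < S) (hS : R0 ≤ S) :
    ∫⁻ z, ENNReal.ofReal (log⁺ ‖z‖ - S) ∂μ ≤ ENNReal.ofReal (|Ct| * (S ^ (1 - ρ) / (ρ - 1))) := by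
  have e : ∀ z : ℂ, ENNReal.ofReal (log⁺ ‖z‖ - S) = ENNReal.ofReal (max (log⁺ ‖z‖ - S) 0) := by
    intro z; simp
  simp_rw [e]
  rw [lintegral_eq_lintegral_meas_lt μ (f := fun z : ℂ => max (log⁺ ‖z‖ - S) 0)
    (ae_of_all _ fun z => le_max_right _ _)
    (by fun_prop)]
  have hi : IntegrableOn (fun t : ℝ => |Ct| * t ^ (-ρ)) (Set.Ioi S) :=
    (integrableOn_Ioi_rpow_of_lt (by linarith) hS0).const_mul _
  calc _ ≤ ∫⁻ t in Set.Ioi (0:ℝ), ENNReal.ofReal (|Ct| * (t + S) ^ (-ρ)) := by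
        refine setLIntegral_mono' measurableSet_Ioi fun t ht => ?_
        have ht : 0 < t := ht
        calc _ ≤ μ {z : ℂ | t + S < Real.log ‖z‖} := by
              refine measure_mono fun z hz => ?_
              simp only [Set.mem_ofPred_eq, posLog_apply] at hz ⊢
              rcases lt_max_iff.1 hz with h | h
              · rcases lt_max_iff.1 (lt_sub_iff_add_lt.1 h) with h | h <;> linarith
              · linarith
          _ ≤ _ := htail _ (by linarith)
          _ ≤ _ := by
              gcongr
              exact le_abs_self _
    _ = ∫⁻ t in Set.Ioi S, ENNReal.ofReal (|Ct| * t ^ (-ρ)) := by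
        have := (measurePreserving_add_right (volume : Measure ℝ) S).setLIntegral_comp_preimage
          (s := Set.Ioi S) measurableSet_Ioi
          (f := fun t => ENNReal.ofReal (|Ct| * t ^ (-ρ))) (by fun_prop)
        simpa using this
    _ = _ := by
        rw [← ofReal_integral_eq_lintegral_ofReal hi]
        · rw [integral_const_mul, integral_Ioi_rpow_of_lt (by linarith) hS0]
          congr 2
          rw [show -ρ + 1 = -(ρ - 1) by ring, neg_div_neg_eq, neg_sub]
        · filter_upwards [ae_restrict_mem measurableSet_Ioi] with t ht
          have : 0 < t := hS0.trans ht
          positivity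

lemma aux_abs_log (x : ℝ) : |log x| = log⁺ x + log⁺ x⁻¹ := by
  simp only [posLog_apply, log_inv]
  rcases le_total 0 (log x) with h | h
  · rw [abs_of_nonneg h, max_eq_right h, max_eq_left (by linarith), add_zero]
  · rw [abs_of_nonpos h, max_eq_left h, max_eq_right (by linarith), zero_add]

lemma aux_exists_big {N : ℕ} (u : Fin N → ℂ) (hu : (∑ j, ‖u j‖ ^ 2) = 1) :
    ∃ k, u k ≠ 0 ∧ log⁺ ‖u k‖⁻¹ ≤ log N := by
  have hN : N ≠ 0 := by
    rintro rfl
    simp at hu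
  have hN1 : (1:ℝ) ≤ N := by exact_mod_cast Nat.one_le_iff_ne_zero.2 hN
  have : ∃ k, ((N:ℝ)⁻¹) ≤ ‖u k‖ ^ 2 := by
    by_contra! h
    have : NeZero N := ⟨hN⟩
    have h2 : ∑ j, ‖u j‖ ^ 2 < ∑ j : Fin N, (N:ℝ)⁻¹ :=
      Finset.sum_lt_sum_of_nonempty Finset.univ_nonempty fun j _ => h j
    rw [hu] at h2
    simp [hN] at h2
  obtain ⟨k, hk⟩ := this
  have hk1 : ‖u k‖ ^ 2 ≤ 1 := by
    rw [← hu]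
    exact Finset.single_le_sum (f := fun j => ‖u j‖ ^ 2) (fun j _ => by positivity)
      (Finset.mem_univ k)
  have hk0 : u k ≠ 0 := by
    intro h
    rw [h] at hk
    have : (0:ℝ) < (N:ℝ)⁻¹ := by positivity
    simp at hk
    exact hN hk
  have hpos : 0 < ‖u k‖ := norm_pos_iff.2 hk0
  have hle1 : ‖u k‖ ≤ 1 := by nlinarith
  refine ⟨k, hk0, ?_⟩
  rw [← log_of_nat_eq_posLog]
  refine posLog_le_posLog (by positivity) ?_
  rw [inv_le_comm₀ hpos (by positivity)]
  nlinarith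

lemma aux_upper {N : ℕ} (μ : Measure ℂ) [IsProbabilityMeasure μ] (u : Fin N → ℂ)
    (hu : (∑ j, ‖u j‖ ^ 2) = 1) (S : ℝ) (hS : 0 ≤ S) :
    ∫⁻ a, ENNReal.ofReal (log⁺ ‖∑ j, a j * u j‖) ∂(Measure.pi fun _ : Fin N => μ)
      ≤ ENNReal.ofReal (log N + S) + N * ∫⁻ z, ENNReal.ofReal (log⁺ ‖z‖ - S) ∂μ := by
  have hN : N ≠ 0 := by
    rintro rfl
    simp at hu
  have hN1 : (1:ℝ) ≤ N := by exact_mod_cast Nat.one_le_iff_ne_zero.2 hN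
  have : NeZero N := ⟨hN⟩
  have hlogN : 0 ≤ log N := log_nonneg hN1
  have key : ∀ a : Fin N → ℂ, ENNReal.ofReal (log⁺ ‖∑ j, a j * u j‖) ≤
      ENNReal.ofReal (log N + S) + ∑ j, ENNReal.ofReal (log⁺ ‖a j‖ - S) := by
    intro a
    obtain ⟨k, -, hk⟩ := Finset.exists_max_image Finset.univ (fun j => ‖a j‖)
      Finset.univ_nonempty
    have h1 : ‖∑ j, a j * u j‖ ≤ N * ‖a k‖ := by
      calc _ ≤ ∑ j, ‖a j * u j‖ := norm_sum_le _ _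
        _ ≤ ∑ j : Fin N, ‖a k‖ := by
            refine Finset.sum_le_sum fun j _ => ?_
            have h2 : ‖u j‖ ^ 2 ≤ 1 := by
              rw [← hu]
              exact Finset.single_le_sum (f := fun j => ‖u j‖ ^ 2) (fun j _ => by positivity)
                (Finset.mem_univ j)
            have h3 : ‖u j‖ ≤ 1 := by nlinarith [norm_nonneg (u j)]
            rw [norm_mul]
            calc _ ≤ ‖a j‖ * 1 := by gcongr
              _ ≤ _ := by simpa using hk j (Finset.mem_univ j)
        _ = _ := by simp
    have h4 : log⁺ ‖∑ j, a j * u j‖ ≤ log N + log⁺ ‖a k‖ :=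
      (posLog_le_posLog (norm_nonneg _) h1).trans posLog_nat_mul
    calc _ ≤ ENNReal.ofReal ((log N + S) + (log⁺ ‖a k‖ - S)) :=
          ENNReal.ofReal_le_ofReal (by linarith)
      _ ≤ ENNReal.ofReal (log N + S) + ENNReal.ofReal (log⁺ ‖a k‖ - S) := ENNReal.ofReal_add_le
      _ ≤ _ := by
          gcongr
          exact Finset.single_le_sum (f := fun j => ENNReal.ofReal (log⁺ ‖a j‖ - S))
            (fun _ _ => zero_le) (Finset.mem_univ k)
  refine (lintegral_mono key).trans ?_
  rw [lintegral_add_left measurable_const, lintegral_finsetSum _ (fun j _ => by fun_prop)]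
  have h5 : ∀ j : Fin N, ∫⁻ a, ENNReal.ofReal (log⁺ ‖a j‖ - S) ∂(Measure.pi fun _ : Fin N => μ)
      = ∫⁻ z, ENNReal.ofReal (log⁺ ‖z‖ - S) ∂μ := fun j =>
    (measurePreserving_eval (fun _ : Fin N => μ) j).lintegral_comp
      (f := fun z : ℂ => ENNReal.ofReal (log⁺ ‖z‖ - S)) (by fun_prop)
  simp [h5]

lemma aux_meas_sum {N : ℕ} (u : Fin N → ℂ) :
    Measurable fun a : Fin N → ℂ => ‖∑ j, a j * u j‖ := by fun_prop

lemma aux_lower {N : ℕ} (μ : Measure ℂ) [IsProbabilityMeasure μ] (C : ℝ) (hC : 0 ≤ C)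
    (hμ : μ ≤ ENNReal.ofReal C • (volume : Measure ℂ)) (u : Fin N → ℂ)
    (hu : (∑ j, ‖u j‖ ^ 2) = 1) :
    ∫⁻ a, ENNReal.ofReal (log⁺ ‖∑ j, a j * u j‖⁻¹) ∂(Measure.pi fun _ : Fin N => μ)
      ≤ ENNReal.ofReal (log N) + ENNReal.ofReal (C * (2 * π)) := by
  obtain ⟨k, hk0, hk⟩ := aux_exists_big u hu
  refine aux_slice_le μ k _ (by fun_prop) _ fun x => ?_
  simp_rw [aux_sum_update]
  set w := ∑ j ∈ Finset.univ.erase k, x j * u j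
  have key : ∀ z : ℂ, ENNReal.ofReal (log⁺ ‖z * u k + w‖⁻¹) ≤
      ENNReal.ofReal (log N) + ENNReal.ofReal (log⁺ ‖z + w / u k‖⁻¹) := by
    intro z
    rw [← ENNReal.ofReal_add (posLog_nonneg.trans hk) posLog_nonneg]
    refine ENNReal.ofReal_le_ofReal ?_
    have : z * u k + w = u k * (z + w / u k) := by field_simp
    rw [this, norm_mul, mul_inv]
    exact posLog_mul.trans (by gcongr)
  refine (lintegral_mono key).trans ?_
  rw [lintegral_add_left measurable_const]
  gcongr
  · simp
  · exact aux_neglog_mu μ C hC hμ _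

lemma aux_top {N : ℕ} (μ : Measure ℂ) [IsProbabilityMeasure μ] (u : Fin N → ℂ)
    (hu : (∑ j, ‖u j‖ ^ 2) = 1) (htop : ∫⁻ z, ENNReal.ofReal (log⁺ ‖z‖) ∂μ = ⊤) :
    ∫⁻ a, ENNReal.ofReal |log ‖∑ j, a j * u j‖| ∂(Measure.pi fun _ : Fin N => μ) = ⊤ := by
  obtain ⟨k, hk0, hk⟩ := aux_exists_big u hu
  rw [eq_top_iff]
  refine aux_slice_ge μ k _ (by fun_prop) _ fun x => ?_
  simp_rw [aux_sum_update]
  set w := ∑ j ∈ Finset.univ.erase k, x j * u j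
  rw [top_le_iff]
  by_contra hne
  have key : ∀ z : ℂ, ENNReal.ofReal (log⁺ ‖z‖) ≤
      ENNReal.ofReal (log⁺ ‖u k‖⁻¹ + log 2 + log⁺ ‖w‖) +
        ENNReal.ofReal |log ‖z * u k + w‖| := by
    intro z
    rw [← ENNReal.ofReal_add (add_nonneg (add_nonneg posLog_nonneg (log_nonneg (by norm_num)))
      posLog_nonneg) (abs_nonneg _)]
    refine ENNReal.ofReal_le_ofReal ?_
    have h1 : ‖z‖ = ‖u k‖⁻¹ * ‖(z * u k + w) + (-w)‖ := by
      have : ‖u k‖ ≠ 0 := norm_ne_zero_iff.2 hk0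
      simp only [add_neg_cancel_right, norm_mul]
      field_simp
    have h2 := posLog_norm_add_le (z * u k + w) (-w)
    have h3 : log⁺ ‖z * u k + w‖ ≤ |log ‖z * u k + w‖| := by
      rw [aux_abs_log]
      linarith [posLog_nonneg (x := ‖z * u k + w‖⁻¹)]
    rw [norm_neg] at h2
    have h4 : log⁺ ‖z‖ ≤ log⁺ ‖u k‖⁻¹ + log⁺ ‖(z * u k + w) + (-w)‖ := by
      conv_lhs => rw [h1]
      exact posLog_mul
    linarith
  have := lintegral_mono (μ := μ) key
  rw [htop, lintegral_add_left measurable_const, top_le_iff] at this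
  simp [hne] at this

lemma aux_total {N : ℕ} (μ : Measure ℂ) [IsProbabilityMeasure μ] (C : ℝ) (hC : 0 ≤ C)
    (hμ : μ ≤ ENNReal.ofReal C • (volume : Measure ℂ)) (u : Fin N → ℂ)
    (hu : (∑ j, ‖u j‖ ^ 2) = 1) (S K : ℝ) (hS : 0 ≤ S) (hK : 0 ≤ K)
    (hJ : (∫⁻ z, ENNReal.ofReal (log⁺ ‖z‖) ∂μ) ≠ ⊤ →
      (N : ENNReal) * ∫⁻ z, ENNReal.ofReal (log⁺ ‖z‖ - S) ∂μ ≤ ENNReal.ofReal K) :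
    ∫ a, |log ‖∑ j, a j * u j‖| ∂(Measure.pi fun _ : Fin N => μ)
      ≤ 2 * log N + S + K + C * (2 * π) := by
  have hlogN : 0 ≤ log N := log_natCast_nonneg N
  have hb : 0 ≤ C * (2 * π) := by positivity
  rw [integral_eq_lintegral_of_nonneg_ae (ae_of_all _ fun _ => abs_nonneg _)
    (by fun_prop : Measurable _).aestronglyMeasurable]
  by_cases htop : ∫⁻ z, ENNReal.ofReal (log⁺ ‖z‖) ∂μ = ⊤
  · rw [aux_top μ u hu htop]
    simp only [ENNReal.toReal_top]
    positivity
  refine ENNReal.toReal_le_of_le_ofReal (by positivity) ?_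
  simp_rw [aux_abs_log, ENNReal.ofReal_add posLog_nonneg posLog_nonneg]
  rw [lintegral_add_left (by fun_prop)]
  refine (add_le_add ((aux_upper μ u hu S hS).trans (add_le_add le_rfl (hJ htop)))
    (aux_lower μ C hC hμ u hu)).trans ?_
  rw [← ENNReal.ofReal_add (by positivity) hK, ← ENNReal.ofReal_add hlogN hb,
    ← ENNReal.ofReal_add (by positivity) (by positivity)]
  exact ENNReal.ofReal_le_ofReal (by linarith)

theorem stmt_5 (m : ℕ) (Cd : ℝ) (d : ℕ → ℕ) (hd : ∀ n, (d n : ℝ) ≤ Cd * (n : ℝ) ^ m)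
    (ρ ε : ℝ) (hε0 : 0 < ε) (hε1 : ε < 1) (hρε : (m : ℝ) ≤ (ρ - 1) * (1 - ε))
    (C : ℝ) (φ : ℂ → ℝ) (hφ : ∀ z, 0 ≤ φ z ∧ φ z ≤ C)
    (μ : Measure ℂ)
    (hμ : μ = volume.withDensity fun z => ENNReal.ofReal (φ z))
    (hprob : IsProbabilityMeasure μ)
    (Ct R0 : ℝ)
    (htail : ∀ R ≥ R0, μ {z : ℂ | R < Real.log ‖z‖} ≤ ENNReal.ofReal (Ct * R ^ (-ρ))) :
    ∃ A > (0 : ℝ), ∃ N : ℕ, ∀ n ≥ N, ∀ u : Fin (d n) → ℂ, (∑ j, ‖u j‖ ^ 2) = 1 →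
      (∫ a : Fin (d n) → ℂ, |Real.log ‖∑ j, a j * u j‖|
          ∂(Measure.pi fun _ : Fin (d n) => μ))
        ≤ A * (n : ℝ) ^ (1 - ε) := by
  have hC : 0 ≤ C := (hφ 0).1.trans (hφ 0).2
  have hle := aux_meas μ C φ hφ hμ
  have hε : 0 < 1 - ε := by linarith
  have hCd : 0 ≤ Cd := by
    have := hd 1
    simp only [Nat.cast_one, one_pow, mul_one] at this
    exact (Nat.cast_nonneg _).trans this
  obtain ⟨K, hK, N0, hN0⟩ : ∃ K ≥ (0:ℝ), ∃ N0 : ℕ, ∀ n ≥ N0, 1 ≤ n →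
      (∫⁻ z, ENNReal.ofReal (log⁺ ‖z‖) ∂μ) ≠ ⊤ →
      (d n : ENNReal) * ∫⁻ z, ENNReal.ofReal (log⁺ ‖z‖ - (n:ℝ) ^ (1 - ε)) ∂μ
        ≤ ENNReal.ofReal K := by
    have hρ : 1 ≤ ρ := by
      by_contra! h
      have h1 : (ρ - 1) * (1 - ε) < 0 := mul_neg_of_neg_of_pos (by linarith) hε
      have h2 : (0:ℝ) ≤ m := Nat.cast_nonneg m
      linarith
    rcases hρ.eq_or_lt with h1 | h1
    · refine ⟨Cd * (∫⁻ z, ENNReal.ofReal (log⁺ ‖z‖) ∂μ).toReal, by positivity, 0, ?_⟩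
      intro n _ hn hfin
      have hm : m = 0 := by
        rw [← h1] at hρε
        simp at hρε
        exact hρε
      have hdn : (d n : ℝ) ≤ Cd := by simpa [hm] using hd n
      rw [ENNReal.ofReal_mul hCd, ENNReal.ofReal_toReal hfin]
      gcongr
      · rw [← ENNReal.ofReal_natCast]
        exact ENNReal.ofReal_le_ofReal hdn
      · have : (0:ℝ) ≤ (n:ℝ) ^ (1 - ε) := by positivity
        linarith
    · have hρ1 : 0 < ρ - 1 := by linarith
      have ht : Filter.Tendsto (fun n : ℕ => (n:ℝ) ^ (1 - ε)) Filter.atTop Filter.atTop :=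
        (tendsto_rpow_atTop hε).comp tendsto_natCast_atTop_atTop
      obtain ⟨N0, hN0⟩ := Filter.eventually_atTop.1 (ht.eventually_ge_atTop R0)
      refine ⟨Cd * (|Ct| / (ρ - 1)), by positivity, N0, ?_⟩
      intro n hn hn1 _
      have hnpos : (0:ℝ) < n := by exact_mod_cast hn1
      have hn1' : (1:ℝ) ≤ n := by exact_mod_cast hn1
      have h2 := aux_tail μ ρ Ct R0 h1 htail ((n:ℝ) ^ (1 - ε)) (by positivity) (hN0 n hn)
      refine (mul_le_mul_right h2 _).trans ?_
      rw [← ENNReal.ofReal_natCast, ← ENNReal.ofReal_mul (Nat.cast_nonneg _)]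
      refine ENNReal.ofReal_le_ofReal ?_
      have h3 : (n:ℝ) ^ m * ((n:ℝ) ^ (1 - ε)) ^ (1 - ρ) ≤ 1 := by
        rw [← rpow_mul hnpos.le, ← rpow_natCast, ← rpow_add hnpos]
        refine rpow_le_one_of_one_le_of_nonpos hn1' ?_
        linarith
      calc _ ≤ (Cd * (n:ℝ) ^ m) * (|Ct| * (((n:ℝ) ^ (1 - ε)) ^ (1 - ρ) / (ρ - 1))) := by
            gcongr
            exact hd n
        _ = Cd * (|Ct| / (ρ - 1)) * ((n:ℝ) ^ m * ((n:ℝ) ^ (1 - ε)) ^ (1 - ρ)) := by ring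
        _ ≤ Cd * (|Ct| / (ρ - 1)) * 1 := by gcongr
        _ = _ := mul_one _
  refine ⟨2 * (|log Cd| + m / (1 - ε)) + 1 + K + C * (2 * π), by positivity, max N0 1, ?_⟩
  intro n hn u hu
  have hn1 : 1 ≤ n := (le_max_right _ _).trans hn
  have hnpos : (0:ℝ) < n := by exact_mod_cast hn1
  have hn1' : (1:ℝ) ≤ n := by exact_mod_cast hn1
  have hS1 : (1:ℝ) ≤ (n:ℝ) ^ (1 - ε) := one_le_rpow hn1' hε.le
  refine (aux_total μ C hC hle u hu _ K (by positivity) hK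
    (hN0 n ((le_max_left _ _).trans hn) hn1)).trans ?_
  have hdne : d n ≠ 0 := by
    intro h
    have : IsEmpty (Fin (d n)) := by rw [h]; infer_instance
    simp at hu
  have hdpos : (0:ℝ) < d n := by exact_mod_cast Nat.pos_of_ne_zero hdne
  have hCd0 : Cd ≠ 0 := by
    rintro rfl
    have := hd n
    simp only [zero_mul] at this
    linarith
  have hlog : log (d n) ≤ (|log Cd| + m / (1 - ε)) * (n:ℝ) ^ (1 - ε) := by
    have h1 : log (d n) ≤ log Cd + m * log n := by
      rw [← log_pow, ← log_mul hCd0 (by positivity)]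
      exact log_le_log hdpos (hd n)
    have h2 := log_le_rpow_div hnpos.le hε
    have h3 : (m:ℝ) * log n ≤ m * ((n:ℝ) ^ (1 - ε) / (1 - ε)) := by gcongr
    have h4 : log Cd ≤ |log Cd| * (n:ℝ) ^ (1 - ε) :=
      (le_abs_self _).trans (le_mul_of_one_le_right (abs_nonneg _) hS1)
    calc _ ≤ _ := h1.trans (add_le_add h4 h3)
      _ = _ := by ring
  have hK2 : K ≤ K * (n:ℝ) ^ (1 - ε) := le_mul_of_one_le_right hK hS1
  have hC2 : C * (2 * π) ≤ C * (2 * π) * (n:ℝ) ^ (1 - ε) :=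
    le_mul_of_one_le_right (by positivity) hS1
  linarith
end

section
/- Let u ∈ ℂ^{d_n} be a unit vector with d_n ≤ Cn^m, and let a have i.i.d. coordinates with bounded density ≤ C and tail P{log|z| > R} = O(R^{-ρ}) where (ρ-1)(1-ε) ≥ m. Then ∫_{ℂ^{d_n}} (log|⟨a,u⟩|)² dP_n(a) ≤ C_m n^{2-2ε} for all sufficiently large n, with C_m independent of u and n. -/
open MeasureTheory Real

noncomputable def hfun : ℂ → ENNReal :=
  Set.indicator (Metric.closedBall 0 1) (fun z => ENNReal.ofReal (4 * ‖z‖⁻¹))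

noncomputable def gfun (T : ℝ) : ℂ → ENNReal :=
  Set.indicator {z : ℂ | T < Real.log ‖z‖} (fun z => ENNReal.ofReal ((Real.log ‖z‖) ^ 2))

theorem hfun_meas : Measurable hfun := by
  unfold hfun
  exact Measurable.indicator (by fun_prop) Metric.isClosed_closedBall.measurableSet

theorem gfun_meas (T : ℝ) : Measurable (gfun T) := by
  unfold gfun
  refine Measurable.indicator (by fun_prop) ?_
  exact measurableSet_lt (by fun_prop) (by fun_prop)

theorem hfun_int : ∫⁻ z, hfun z < ⊤ := by
  rw [← Complex.lintegral_comp_polarCoord_symm]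
  have hle : ∀ p ∈ polarCoord.target, ENNReal.ofReal p.1 • hfun (Complex.polarCoord.symm p)
      ≤ Set.indicator (Set.Icc (0:ℝ) 1 ×ˢ Set.Icc (-π) π) (fun _ => (4 : ENNReal)) p := by
    intro p hp
    rw [polarCoord_target] at hp
    obtain ⟨h1, h2⟩ := hp
    have h1 : 0 < p.1 := h1
    have hn : ‖Complex.polarCoord.symm p‖ = p.1 := by
      rw [Complex.norm_polarCoord_symm, abs_of_pos h1]
    unfold hfun
    by_cases hp1 : p.1 ≤ 1
    · rw [Set.indicator_of_mem (by rw [mem_closedBall_zero_iff, hn]; exact hp1), Set.indicator_of_mem, hn, smul_eq_mul,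
        ← ENNReal.ofReal_mul h1.le]
      · have : p.1 * (4 * p.1⁻¹) = 4 := by field_simp
        rw [this]; simp
      · exact ⟨⟨h1.le, hp1⟩, ⟨h2.1.le, h2.2.le⟩⟩
    · rw [Set.indicator_of_notMem (by rw [mem_closedBall_zero_iff, hn]; exact hp1)]; simp
  refine (setLIntegral_mono' polarCoord.open_target.measurableSet hle).trans_lt ?_
  refine (setLIntegral_le_lintegral _ _).trans_lt ?_
  rw [lintegral_indicator_const (measurableSet_Icc.prod measurableSet_Icc)]
  refine ENNReal.mul_lt_top (by simp) ?_
  exact (isCompact_Icc.prod isCompact_Icc).measure_lt_top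

theorem log_sq_le (r : ℝ) (h0 : 0 < r) (h1 : r ≤ 1) : (Real.log r) ^ 2 ≤ 4 * r⁻¹ := by
  have h := Real.log_le_rpow_div (x := r⁻¹) (ε := 1/2) (by positivity) (by norm_num)
  rw [Real.log_inv] at h
  have h2 : 0 ≤ - Real.log r := by have := Real.log_nonpos h0.le h1; linarith
  have h3 : ((r⁻¹) ^ (1/2:ℝ)) ^ 2 = r⁻¹ := by
    rw [← Real.rpow_natCast, ← Real.rpow_mul (by positivity)]; norm_num
  have h4 : (- Real.log r)^2 ≤ ((r⁻¹) ^ (1/2:ℝ) / (1/2)) ^ 2 := pow_le_pow_left₀ h2 h 2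
  rw [div_pow, h3] at h4
  linarith [h4, neg_sq (Real.log r), show r⁻¹ / (1/2:ℝ)^2 = 4 * r⁻¹ by ring]

theorem pointwise (k : ℕ) (u : Fin (k+1) → ℂ) (hu : ∑ j, ‖u j‖ ^ 2 = 1) (j : Fin (k+1))
    (hj : 1 / ((k+1 : ℕ) : ℝ) ≤ ‖u j‖ ^ 2) (T : ℝ) (hT : 0 ≤ T) (a : Fin (k+1) → ℂ) :
    ENNReal.ofReal ((Real.log ‖∑ i, a i * u i‖) ^ 2) ≤
      ENNReal.ofReal (2 * (Real.log ((k+1 : ℕ) : ℝ)) ^ 2 + 2 * T ^ 2) + 2 * ∑ i, gfun T (a i)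
        + 2 * hfun (a j + (∑ i, a (j.succAbove i) * u (j.succAbove i)) / u j) := by
  set S := ‖∑ i, a i * u i‖ with hS
  set D : ℝ := ((k+1 : ℕ) : ℝ) with hD
  have hD1 : 1 ≤ D := by rw [hD]; push_cast; linarith [(Nat.cast_nonneg k : (0:ℝ) ≤ k)]
  have hlD : 0 ≤ Real.log D := Real.log_nonneg hD1
  have hS0 : 0 ≤ S := norm_nonneg _
  have hu1 : ∀ i, ‖u i‖ ≤ 1 := by
    intro i
    have : ‖u i‖ ^ 2 ≤ 1 := by
      rw [← hu]; exact Finset.single_le_sum (f := fun i => ‖u i‖^2) (fun _ _ => by positivity) (Finset.mem_univ i)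
    nlinarith [norm_nonneg (u i)]
  have hujp : 0 < ‖u j‖ := by
    rcases (norm_nonneg (u j)).lt_or_eq with h | h
    · exact h
    · rw [← h] at hj
      have : 0 < 1 / D := by positivity
      norm_num at hj; linarith
  have huj0 : u j ≠ 0 := norm_pos_iff.mp hujp
  rcases lt_or_ge 1 S with h1 | h1
  · -- upper range
    obtain ⟨i, -, hi⟩ : ∃ i ∈ (Finset.univ : Finset (Fin (k+1))), S / D ≤ ‖a i‖ := by
      apply Finset.exists_le_of_sum_le Finset.univ_nonempty
      simp only [Finset.sum_const, Finset.card_univ, Fintype.card_fin, nsmul_eq_mul]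
      rw [← hD, mul_div_cancel₀ _ (by positivity)]
      refine (norm_sum_le _ _).trans (Finset.sum_le_sum fun i _ => ?_)
      rw [norm_mul]
      exact mul_le_of_le_one_right (norm_nonneg _) (hu1 i)
    have hlS : 0 < Real.log S := Real.log_pos h1
    have hlog : Real.log S ≤ Real.log D + Real.log ‖a i‖ := by
      have := Real.log_le_log (by positivity) hi
      rw [Real.log_div (by positivity) (by positivity)] at this
      linarith
    by_cases hT' : T < Real.log ‖a i‖
    · have hg : gfun T (a i) = ENNReal.ofReal ((Real.log ‖a i‖) ^ 2) := by
        unfold gfun; rw [Set.indicator_of_mem]; exact hT'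
      have hs : gfun T (a i) ≤ ∑ i, gfun T (a i) :=
        Finset.single_le_sum (f := fun i => gfun T (a i)) (fun _ _ => zero_le) (Finset.mem_univ i)
      calc _ ≤ ENNReal.ofReal ((2 * (Real.log D) ^ 2 + 2 * T ^ 2) + 2 * (Real.log ‖a i‖) ^ 2) := by
            apply ENNReal.ofReal_le_ofReal
            nlinarith [sq_nonneg (Real.log D - Real.log ‖a i‖), sq_nonneg T]
        _ = ENNReal.ofReal (2 * (Real.log D) ^ 2 + 2 * T ^ 2) + 2 * gfun T (a i) := by
            rw [ENNReal.ofReal_add (by positivity) (by positivity), hg,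
              ENNReal.ofReal_mul (by norm_num : (0:ℝ) ≤ 2)]
            simp
        _ ≤ ENNReal.ofReal (2 * (Real.log D) ^ 2 + 2 * T ^ 2) + 2 * ∑ i, gfun T (a i) := by gcongr
        _ ≤ _ := le_self_add
    · refine le_trans ?_ (le_trans le_self_add le_self_add)
      apply ENNReal.ofReal_le_ofReal
      push Not at hT'
      nlinarith [sq_nonneg (Real.log D - T)]
  · rcases hS0.lt_or_eq with hSp | hSz
    · set w := a j + (∑ i, a (j.succAbove i) * u (j.succAbove i)) / u j with hw
      have hSw : S = ‖u j‖ * ‖w‖ := by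
        rw [hS, ← norm_mul, Fin.sum_univ_succAbove _ j, hw]
        congr 1; field_simp
      have hwp : 0 < ‖w‖ := by
        rcases (norm_nonneg w).lt_or_eq with h | h
        · exact h
        · rw [← h] at hSw; simp at hSw; linarith
      have hlS : Real.log S ≤ 0 := Real.log_nonpos hS0 h1
      have hlog : Real.log S = Real.log ‖u j‖ + Real.log ‖w‖ := by
        rw [hSw, Real.log_mul hujp.ne' hwp.ne']
      have hluj : - Real.log D ≤ Real.log ‖u j‖ := by
        have := Real.log_le_log (by positivity) hj
        rw [Real.log_div (by positivity) (by positivity), Real.log_pow] at this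
        simp at this
        linarith
      by_cases hw1 : ‖w‖ ≤ 1
      · have hh : hfun w = ENNReal.ofReal (4 * ‖w‖⁻¹) := by
          unfold hfun; rw [Set.indicator_of_mem]; simpa using hw1
        have hsq := log_sq_le _ hwp hw1
        calc _ ≤ ENNReal.ofReal ((2 * (Real.log D) ^ 2 + 2 * T ^ 2) + 2 * (4 * ‖w‖⁻¹)) := by
              apply ENNReal.ofReal_le_ofReal
              nlinarith [sq_nonneg (Real.log D + Real.log ‖w‖), sq_nonneg T]
          _ = ENNReal.ofReal (2 * (Real.log D) ^ 2 + 2 * T ^ 2) + 2 * hfun w := by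
              rw [ENNReal.ofReal_add (by positivity) (by positivity), hh,
                ENNReal.ofReal_mul (p := 2) (by norm_num : (0:ℝ) ≤ 2)]
              simp
          _ ≤ _ := by gcongr; exact le_self_add
      · have hlw : 0 < Real.log ‖w‖ := Real.log_pos (by linarith)
        refine le_trans ?_ (le_trans le_self_add le_self_add)
        apply ENNReal.ofReal_le_ofReal
        nlinarith [sq_nonneg T]
    · rw [← hSz]; simp

theorem lower_int (k : ℕ) (μ : Measure ℂ) [IsProbabilityMeasure μ] (C : ℝ)
    (hμ : μ ≤ ENNReal.ofReal C • volume) (u : Fin (k+1) → ℂ) (j : Fin (k+1)) :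
    ∫⁻ a, hfun (a j + (∑ i, a (j.succAbove i) * u (j.succAbove i)) / u j)
      ∂(Measure.pi fun _ : Fin (k+1) => μ) ≤ ENNReal.ofReal C * ∫⁻ z, hfun z := by
  have hmp := measurePreserving_piFinSuccAbove (fun _ : Fin (k+1) => μ) j
  have hm : Measurable fun p : ℂ × (Fin k → ℂ) =>
      hfun (p.1 + (∑ i, p.2 i * u (j.succAbove i)) / u j) := 
    hfun_meas.comp (by fun_prop)
  have := hmp.lintegral_comp hm
  refine le_trans (le_of_eq this) ?_
  rw [lintegral_prod_symm _ hm.aemeasurable]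
  calc _ ≤ ∫⁻ y, (ENNReal.ofReal C * ∫⁻ z, hfun z) ∂(Measure.pi fun _ : Fin k => μ) := by
        apply lintegral_mono
        intro y
        refine (lintegral_mono' hμ le_rfl).trans ?_
        rw [lintegral_smul_measure, smul_eq_mul]
        have he := lintegral_add_right_eq_self (μ := (volume : Measure ℂ)) hfun
          ((∑ i, y i * u (j.succAbove i)) / u j)
        simp only [] at he ⊢
        rw [he]
    _ = _ := by simp

theorem key (k : ℕ) (μ : Measure ℂ) [IsProbabilityMeasure μ] (C : ℝ)
    (hμ : μ ≤ ENNReal.ofReal C • volume)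
    (u : Fin (k+1) → ℂ) (hu : ∑ j, ‖u j‖ ^ 2 = 1) (T : ℝ) (hT : 0 ≤ T) :
    ∫⁻ a, ENNReal.ofReal ((Real.log ‖∑ i, a i * u i‖) ^ 2) ∂(Measure.pi fun _ : Fin (k+1) => μ) ≤
      ENNReal.ofReal (2 * (Real.log ((k+1 : ℕ) : ℝ)) ^ 2 + 2 * T ^ 2)
        + 2 * (((k+1 : ℕ) : ENNReal) * ∫⁻ z, gfun T z ∂μ)
        + 2 * (ENNReal.ofReal C * ∫⁻ z, hfun z) := by
  obtain ⟨j, -, hj⟩ : ∃ j ∈ (Finset.univ : Finset (Fin (k+1))), 1 / ((k+1 : ℕ) : ℝ) ≤ ‖u j‖^2 := by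
    apply Finset.exists_le_of_sum_le Finset.univ_nonempty
    rw [hu]
    simp only [Finset.sum_const, Finset.card_univ, Fintype.card_fin, nsmul_eq_mul]
    rw [mul_one_div_cancel (by positivity)]
  refine (lintegral_mono (pointwise k u hu j hj T hT)).trans ?_
  have hgm : ∀ i : Fin (k+1), Measurable fun a : Fin (k+1) → ℂ => gfun T (a i) :=
    fun i => (gfun_meas T).comp (measurable_pi_apply i)
  have hgs : Measurable fun a : Fin (k+1) → ℂ => ∑ i, gfun T (a i) :=
    Finset.measurable_sum _ fun i _ => hgm i
  rw [lintegral_add_left (by fun_prop), lintegral_add_left (by fun_prop),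
    lintegral_const_mul _ hgs, lintegral_const_mul' _ _ (by simp), lintegral_finsetSum _ fun i _ => hgm i]
  gcongr
  · simp
  · apply le_of_eq
    have : ∀ i : Fin (k+1), ∫⁻ a, gfun T (a i) ∂(Measure.pi fun _ : Fin (k+1) => μ) = ∫⁻ z, gfun T z ∂μ :=
      fun i => (measurePreserving_eval (fun _ : Fin (k+1) => μ) i).lintegral_comp (gfun_meas T)
    simp [this]
  · exact lower_int k μ C hμ u j

theorem tailint (μ : Measure ℂ) (ρ : ℝ) (hρ : 2 < ρ) (Ct R0 : ℝ)
    (htail : ∀ R ≥ R0, μ {z : ℂ | R < Real.log ‖z‖} ≤ ENNReal.ofReal (Ct * R ^ (-ρ))) :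
    ∃ K ≥ (0:ℝ), ∀ T ≥ max R0 1, ∫⁻ z, gfun T z ∂μ ≤ ENNReal.ofReal (K * T ^ (2 - ρ)) := by
  have hq1 : (2:ℝ) ^ (2 - ρ) < 1 := Real.rpow_lt_one_of_one_lt_of_neg (by norm_num) (by linarith)
  have hq0 : 0 < (2:ℝ) ^ (2 - ρ) := by positivity
  set q := (2:ℝ) ^ (2 - ρ) with hq
  refine ⟨4 * |Ct| * (∑' k : ℕ, q ^ k), by positivity, fun T hT => ?_⟩
  have hT1 : 1 ≤ T := (le_max_right _ _).trans hT
  have hTR : R0 ≤ T := (le_max_left _ _).trans hT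
  have hT0 : 0 < T := by linarith
  have hms : ∀ R : ℝ, MeasurableSet {z : ℂ | R < Real.log ‖z‖} := fun R =>
    measurableSet_lt (by fun_prop) (by fun_prop)
  have hpt : ∀ z, gfun T z ≤ ∑' k : ℕ, Set.indicator {z : ℂ | T * 2 ^ k < Real.log ‖z‖}
      (fun _ => ENNReal.ofReal ((T * 2 ^ (k+1)) ^ 2)) z := by
    intro z
    by_cases hz : T < Real.log ‖z‖
    · have : ∃ k : ℕ, T * 2 ^ k < Real.log ‖z‖ ∧ Real.log ‖z‖ ≤ T * 2 ^ (k+1) := by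
        have hex : ∃ k : ℕ, Real.log ‖z‖ ≤ T * 2 ^ k := by
          obtain ⟨k, hk⟩ := pow_unbounded_of_one_lt (Real.log ‖z‖ / T) (by norm_num : (1:ℝ) < 2)
          refine ⟨k, ?_⟩
          rw [div_lt_iff₀ hT0] at hk
          linarith
        classical
        have h1 := Nat.find_spec hex
        have h2 := fun m => Nat.find_min hex (m := m)
        rcases hk : Nat.find hex with _ | k
        · rw [hk] at h1; simp at h1; linarith
        · rw [hk] at h1
          exact ⟨k, not_le.mp (h2 k (by omega)), h1⟩
      obtain ⟨k, hk1, hk2⟩ := this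
      refine le_trans ?_ (ENNReal.le_tsum k)
      unfold gfun
      rw [Set.indicator_of_mem (by exact hz), Set.indicator_of_mem (by exact hk1)]
      exact ENNReal.ofReal_le_ofReal (pow_le_pow_left₀ (by linarith) hk2 2)
    · unfold gfun
      rw [Set.indicator_of_notMem (by exact hz)]; exact zero_le
  refine (lintegral_mono hpt).trans ?_
  rw [lintegral_tsum (fun k => (measurable_const.indicator (hms _)).aemeasurable)]
  have hterm : ∀ k : ℕ, ∫⁻ z, Set.indicator {z : ℂ | T * 2 ^ k < Real.log ‖z‖}
      (fun _ => ENNReal.ofReal ((T * 2 ^ (k+1)) ^ 2)) z ∂μ ≤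
      ENNReal.ofReal (4 * |Ct| * T ^ (2 - ρ) * q ^ k) := by
    intro k
    rw [lintegral_indicator_const (hms _)]
    have h2k : (1:ℝ) ≤ 2 ^ k := one_le_pow₀ (by norm_num)
    refine (mul_le_mul_right (htail (T * 2 ^ k) (by nlinarith)) _).trans ?_
    rw [← ENNReal.ofReal_mul (by positivity)]
    apply ENNReal.ofReal_le_ofReal
    have e1 : T ^ (2 - ρ) = T ^ 2 * T ^ (-ρ) := by
      rw [sub_eq_add_neg, Real.rpow_add hT0]; norm_num
    have e2 : q ^ k = ((2:ℝ)^k) ^ 2 * ((2:ℝ)^k) ^ (-ρ) := by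
      rw [hq, sub_eq_add_neg, Real.rpow_add (by norm_num), mul_pow]
      congr 1
      · norm_num; rw [← pow_mul, mul_comm, pow_mul]; norm_num
      · rw [← Real.rpow_natCast, ← Real.rpow_natCast, ← Real.rpow_mul (by norm_num), ← Real.rpow_mul (by norm_num), mul_comm]
    rw [Real.mul_rpow hT0.le (by positivity), e1, e2]
    have hp : 0 ≤ (T ^ 2 * T ^ (-ρ)) * (((2:ℝ)^k) ^ 2 * ((2:ℝ)^k) ^ (-ρ)) := by positivity
    calc _ = 4 * Ct * ((T ^ 2 * T ^ (-ρ)) * (((2:ℝ)^k) ^ 2 * ((2:ℝ)^k) ^ (-ρ))) := by ring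
      _ ≤ 4 * |Ct| * ((T ^ 2 * T ^ (-ρ)) * (((2:ℝ)^k) ^ 2 * ((2:ℝ)^k) ^ (-ρ))) := by
        gcongr; exact le_abs_self _
      _ = _ := by ring
  refine (ENNReal.tsum_le_tsum hterm).trans ?_
  have hsum : Summable fun k : ℕ => q ^ k := summable_geometric_of_lt_one hq0.le hq1
  rw [← ENNReal.ofReal_tsum_of_nonneg (fun k => by positivity) (hsum.mul_left _), tsum_mul_left]
  apply le_of_eq; congr 1; ring

theorem gfun_fin (k : ℕ) (μ : Measure ℂ) [IsProbabilityMeasure μ] 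
    (u : Fin (k+1) → ℂ) (j : Fin (k+1)) (hj : u j ≠ 0)
    (hint : ∫⁻ a, ENNReal.ofReal ((Real.log ‖∑ i, a i * u i‖) ^ 2) 
      ∂(Measure.pi fun _ : Fin (k+1) => μ) ≠ ⊤) (T : ℝ) (hT : 0 ≤ T) :
    ∫⁻ z, gfun T z ∂μ < ⊤ := by
  have hmp := measurePreserving_piFinSuccAbove (fun _ : Fin (k+1) => μ) j
  have hm : Measurable fun p : ℂ × (Fin k → ℂ) =>
      ENNReal.ofReal ((Real.log ‖p.1 * u j + ∑ i, p.2 i * u (j.succAbove i)‖) ^ 2) := by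
    fun_prop
  have h1 := hmp.lintegral_comp hm
  rw [lintegral_prod_symm _ hm.aemeasurable] at h1
  have h2 : (fun a : Fin (k+1) → ℂ => ENNReal.ofReal ((Real.log ‖∑ i, a i * u i‖) ^ 2)) =
      fun a => ENNReal.ofReal ((Real.log ‖a j * u j + ∑ i, a (j.succAbove i) * u (j.succAbove i)‖) ^ 2) := by
    ext a
    rw [Fin.sum_univ_succAbove _ j]
  rw [h2] at hint
  replace hint := fun h => hint (h1.trans h)
  obtain ⟨y, hy⟩ := (ae_lt_top (Measurable.lintegral_prod_left' hm) hint).exists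
  set c := ∑ i, y i * u (j.succAbove i) with hc
  have hy : ∫⁻ x, ENNReal.ofReal ((Real.log ‖x * u j + c‖) ^ 2) ∂μ < ⊤ := hy
  set B : ℝ := Real.posLog ‖u j‖⁻¹ + Real.log 2 + Real.posLog ‖c‖ with hB
  have hB0 : 0 ≤ B := by
    have h := Real.log_pos (by norm_num : (1:ℝ) < 2)
    have h1 := Real.posLog_nonneg (x := ‖u j‖⁻¹)
    have h2 := Real.posLog_nonneg (x := ‖c‖)
    linarith
  have hpt : ∀ z, gfun T z ≤ ENNReal.ofReal (2 * B ^ 2) 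
      + 2 * ENNReal.ofReal ((Real.log ‖z * u j + c‖) ^ 2) := by
    intro z
    by_cases hz : T < Real.log ‖z‖
    · unfold gfun
      rw [Set.indicator_of_mem (by exact hz)]
      have hle : Real.log ‖z‖ ≤ B + |Real.log ‖z * u j + c‖| := by
        have e0 : Real.log ‖z‖ ≤ Real.posLog ‖z‖ := le_max_right _ _
        have e1 : ‖z‖ ≤ ‖u j‖⁻¹ * (‖z * u j + c‖ + ‖c‖) := by
          rw [inv_mul_eq_div, le_div_iff₀ (norm_pos_iff.mpr hj), ← norm_mul]
          calc ‖z * u j‖ = ‖(z * u j + c) - c‖ := by congr 1; ring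
            _ ≤ _ := norm_sub_le _ _
        have e2 := Real.posLog_le_posLog (norm_nonneg z) e1
        have e3 := Real.posLog_mul (x := ‖u j‖⁻¹) (y := ‖z * u j + c‖ + ‖c‖)
        have e4 := Real.posLog_add (x := ‖z * u j + c‖) (y := ‖c‖)
        have e5 : Real.posLog ‖z * u j + c‖ ≤ |Real.log ‖z * u j + c‖| :=
          max_le (abs_nonneg _) (le_abs_self _)
        linarith
      set X := Real.log ‖z * u j + c‖
      calc _ ≤ ENNReal.ofReal (2 * B ^ 2 + 2 * X ^ 2) := by
            apply ENNReal.ofReal_le_ofReal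
            rw [← sq_abs X]
            nlinarith [sq_nonneg (B - |X|), abs_nonneg X]
        _ = _ := by
            rw [ENNReal.ofReal_add (by positivity) (by positivity),
              ENNReal.ofReal_mul (p := 2) (q := X ^ 2) (by norm_num : (0:ℝ) ≤ 2)]
            simp
    · unfold gfun
      rw [Set.indicator_of_notMem (by exact hz)]; exact zero_le
  refine (lintegral_mono hpt).trans_lt ?_
  rw [lintegral_add_left (by fun_prop), lintegral_const_mul' _ _ (by simp)]
  refine ENNReal.add_lt_top.mpr ⟨by rw [lintegral_const, measure_univ, mul_one]; exact ENNReal.ofReal_lt_top, ENNReal.mul_lt_top (by simp) hy⟩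

theorem gfun_anti (T : ℝ) (hT : 0 ≤ T) (z : ℂ) : gfun T z ≤ gfun 0 z := by
  unfold gfun
  exact Set.indicator_le_indicator_of_subset (fun x hx => lt_of_le_of_lt hT hx)
    (fun _ => zero_le) z

theorem log_growth (m : ℕ) (c r : ℝ) (hr : 0 < r) :
    ∃ N : ℕ, ∀ n ≥ N, c + m * Real.log (n : ℝ) ≤ (n : ℝ) ^ r := by
  have h1 : ∀ᶠ x : ℝ in Filter.atTop, ‖Real.log x‖ ≤ (1 / (2 * ((m : ℝ) + 1))) * ‖x ^ r‖ :=
    (isLittleO_log_rpow_atTop hr).bound (by positivity)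
  have h2 : ∀ᶠ x : ℝ in Filter.atTop, 2 * c ≤ x ^ r :=
    (tendsto_rpow_atTop hr).eventually_ge_atTop _
  have h3 := tendsto_natCast_atTop_atTop (R := ℝ) |>.eventually (h1.and h2)
  obtain ⟨N, hN⟩ := Filter.eventually_atTop.mp h3
  refine ⟨N, fun n hn => ?_⟩
  obtain ⟨a, b⟩ := hN n hn
  have hp : (0:ℝ) ≤ (n : ℝ) ^ r := by positivity
  rw [Real.norm_eq_abs, Real.norm_of_nonneg hp] at a
  have a' := (le_abs_self _).trans a
  have hm0 : (0:ℝ) ≤ m := Nat.cast_nonneg m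
  have : (m : ℝ) * Real.log n ≤ (n : ℝ) ^ r / 2 := by
    calc (m : ℝ) * Real.log n ≤ m * ((1 / (2 * ((m : ℝ) + 1))) * (n : ℝ) ^ r) := by gcongr
      _ = (m / (m + 1)) * ((n : ℝ) ^ r / 2) := by field_simp
      _ ≤ 1 * ((n : ℝ) ^ r / 2) := by
        gcongr
        rw [div_le_one (by positivity)]; linarith
      _ = _ := one_mul _
  linarith

theorem upper_est (m : ℕ) (Cd : ℝ) (d : ℕ → ℕ) (hd : ∀ n, (d n : ℝ) ≤ Cd * (n : ℝ) ^ m)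
    (ρ ε : ℝ) (hε0 : 0 < ε) (hε1 : ε < 1) (hρε : (m : ℝ) ≤ (ρ - 1) * (1 - ε))
    (μ : Measure ℂ) (Ct R0 : ℝ)
    (htail : ∀ R ≥ R0, μ {z : ℂ | R < Real.log ‖z‖} ≤ ENNReal.ofReal (Ct * R ^ (-ρ))) :
    ∃ K ≥ (0:ℝ), ∃ N : ℕ, ∀ n ≥ N, (∫⁻ z, gfun 0 z ∂μ = ⊤) ∨
      (d n : ENNReal) * ∫⁻ z, gfun ((n:ℝ) ^ (1 - ε)) z ∂μ
        ≤ ENNReal.ofReal (K * ((n:ℝ) ^ (1 - ε)) ^ 2) := by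
  rcases Nat.eq_zero_or_pos m with hm | hm
  · subst hm
    by_cases hG : ∫⁻ z, gfun 0 z ∂μ = ⊤
    · exact ⟨0, le_rfl, 0, fun n _ => Or.inl hG⟩
    · refine ⟨|Cd| * (∫⁻ z, gfun 0 z ∂μ).toReal, by positivity, 1, fun n hn => Or.inr ?_⟩
      have hn1 : (1:ℝ) ≤ n := by exact_mod_cast hn
      have hT1 : (1:ℝ) ≤ (n:ℝ) ^ (1 - ε) := Real.one_le_rpow hn1 (by linarith)
      have hdn : (d n : ℝ) ≤ |Cd| := by
        have := hd n
        simp only [pow_zero, mul_one] at this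
        exact this.trans (le_abs_self _)
      calc _ ≤ ENNReal.ofReal |Cd| * ∫⁻ z, gfun 0 z ∂μ := by
            gcongr
            · rw [← ENNReal.ofReal_natCast]; exact ENNReal.ofReal_le_ofReal hdn
            · exact gfun_anti _ (by linarith) _
        _ = ENNReal.ofReal (|Cd| * (∫⁻ z, gfun 0 z ∂μ).toReal) := by
            rw [ENNReal.ofReal_mul (abs_nonneg _), ENNReal.ofReal_toReal hG]
        _ ≤ _ := by
            apply ENNReal.ofReal_le_ofReal
            apply le_mul_of_one_le_right (by positivity)
            exact one_le_pow₀ hT1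
  · have hm1 : (1:ℝ) ≤ m := by exact_mod_cast hm
    have hρ : 2 < ρ := by nlinarith
    obtain ⟨K, hK0, hK⟩ := tailint μ ρ hρ Ct R0 htail
    obtain ⟨N, hN⟩ := log_growth 0 (max R0 1) (1 - ε) (by linarith)
    refine ⟨|Cd| * K, by positivity, max N 1, fun n hn => Or.inr ?_⟩
    have hn1 : (1:ℝ) ≤ n := by exact_mod_cast (le_max_right _ _).trans hn
    have hTm : max R0 1 ≤ (n:ℝ) ^ (1 - ε) := by
      have := hN n ((le_max_left _ _).trans hn)
      simpa using this
    have hT1 : (1:ℝ) ≤ (n:ℝ) ^ (1 - ε) := (le_max_right _ _).trans hTm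
    have hnm : (n:ℝ) ^ m ≤ ((n:ℝ) ^ (1 - ε)) ^ (ρ - 1) := by
      rw [← Real.rpow_mul (by positivity), ← Real.rpow_natCast]
      exact Real.rpow_le_rpow_of_exponent_le hn1 (by linarith)
    set T := (n:ℝ) ^ (1 - ε)
    have hdn : (d n : ℝ) ≤ |Cd| * T ^ (ρ - 1) := by
      refine (hd n).trans ?_
      gcongr
      exact le_abs_self _
    calc _ ≤ ENNReal.ofReal (|Cd| * T ^ (ρ - 1)) * ENNReal.ofReal (K * T ^ (2 - ρ)) := by
          gcongr
          · rw [← ENNReal.ofReal_natCast]; exact ENNReal.ofReal_le_ofReal hdn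
          · exact hK T hTm
      _ = ENNReal.ofReal (|Cd| * K * T) := by
          rw [← ENNReal.ofReal_mul (by positivity)]
          congr 1
          have : T ^ (ρ - 1) * T ^ (2 - ρ) = T := by
            rw [← Real.rpow_add (by linarith)]; ring_nf; simp
          calc _ = |Cd| * K * (T ^ (ρ - 1) * T ^ (2 - ρ)) := by ring
            _ = _ := by rw [this]
      _ ≤ _ := by
          apply ENNReal.ofReal_le_ofReal
          gcongr
          nlinarith

theorem stmt_6 (m : ℕ) (Cd : ℝ) (d : ℕ → ℕ) (hd : ∀ n, (d n : ℝ) ≤ Cd * (n : ℝ) ^ m)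
    (ρ ε : ℝ) (hε0 : 0 < ε) (hε1 : ε < 1) (hρε : (m : ℝ) ≤ (ρ - 1) * (1 - ε))
    (C : ℝ) (φ : ℂ → ℝ) (hφ : ∀ z, 0 ≤ φ z ∧ φ z ≤ C)
    (μ : Measure ℂ)
    (hμ : μ = volume.withDensity fun z => ENNReal.ofReal (φ z))
    (hprob : IsProbabilityMeasure μ)
    (Ct R0 : ℝ)
    (htail : ∀ R ≥ R0, μ {z : ℂ | R < Real.log ‖z‖} ≤ ENNReal.ofReal (Ct * R ^ (-ρ))) :
    ∃ A > (0 : ℝ), ∃ N : ℕ, ∀ n ≥ N, ∀ u : Fin (d n) → ℂ, (∑ j, ‖u j‖ ^ 2) = 1 →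
      (∫ a : Fin (d n) → ℂ, (Real.log ‖∑ j, a j * u j‖) ^ 2
          ∂(Measure.pi fun _ : Fin (d n) => μ))
        ≤ A * (n : ℝ) ^ (2 - 2 * ε) := by
  have hC : 0 ≤ C := (hφ 0).1.trans (hφ 0).2
  have hle : μ ≤ ENNReal.ofReal C • volume := by
    rw [hμ, ← withDensity_const]
    exact withDensity_mono (Filter.Eventually.of_forall fun z => ENNReal.ofReal_le_ofReal (hφ z).2)
  obtain ⟨K, hK0, N1, hK⟩ := upper_est m Cd d hd ρ ε hε0 hε1 hρε μ Ct R0 htail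
  obtain ⟨N2, hN2⟩ := log_growth m (Real.log (|Cd| + 1)) (1 - ε) (by linarith)
  have hMfin : ENNReal.ofReal C * ∫⁻ z, hfun z ≠ ⊤ :=
    (ENNReal.mul_lt_top (by simp) hfun_int).ne
  set M := (ENNReal.ofReal C * ∫⁻ z, hfun z).toReal with hM
  have hM0 : 0 ≤ M := ENNReal.toReal_nonneg
  refine ⟨4 + 2 * K + 2 * M, by positivity, max (max N1 N2) 1, fun n hn u hu => ?_⟩
  have hnN1 : N1 ≤ n := (le_max_left _ _).trans ((le_max_left _ _).trans hn)
  have hnN2 : N2 ≤ n := (le_max_right _ _).trans ((le_max_left _ _).trans hn)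
  have hn1 : (1:ℝ) ≤ n := by exact_mod_cast (le_max_right _ _).trans hn
  have hT1 : (1:ℝ) ≤ (n:ℝ) ^ (1 - ε) := Real.one_le_rpow hn1 (by linarith)
  have hTT : (n:ℝ) ^ (2 - 2 * ε) = ((n:ℝ) ^ (1 - ε)) ^ 2 := by
    rw [← Real.rpow_natCast, ← Real.rpow_mul (by positivity)]; congr 1; push_cast; ring
  have hdn := hd n
  have hup := hK n hnN1
  have hlg := hN2 n hnN2
  rw [hTT]
  set T := (n:ℝ) ^ (1 - ε) with hT
  generalize d n = D at u hu hdn hup ⊢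
  rcases D with _ | k
  · simp at hu
  have hlogD : Real.log ((k+1 : ℕ) : ℝ) ≤ T := by
    refine le_trans ?_ hlg
    rw [← Real.log_pow, ← Real.log_mul (by positivity) (by positivity)]
    apply Real.log_le_log (by positivity)
    refine hdn.trans ?_
    gcongr
    linarith [le_abs_self Cd]
  have hlogD0 : 0 ≤ Real.log ((k+1 : ℕ) : ℝ) := Real.log_natCast_nonneg _
  have hpos : 0 ≤ (4 + 2 * K + 2 * M) * T ^ 2 := by positivity
  rw [integral_eq_lintegral_of_nonneg_ae (Filter.Eventually.of_forall fun a => sq_nonneg _)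
    (Measurable.aestronglyMeasurable (by fun_prop))]
  by_cases hfin : ∫⁻ a, ENNReal.ofReal ((Real.log ‖∑ i, a i * u i‖) ^ 2)
      ∂(Measure.pi fun _ : Fin (k+1) => μ) = ⊤
  · rw [hfin]; simpa using hpos
  have hG : ∫⁻ z, gfun 0 z ∂μ ≠ ⊤ := by
    obtain ⟨j, hj⟩ : ∃ j, u j ≠ 0 := by
      by_contra! h
      simp [h] at hu
    exact (gfun_fin k μ u j hj hfin 0 le_rfl).ne
  have hup := hup.resolve_left hG
  apply ENNReal.toReal_le_of_le_ofReal hpos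
  refine (key k μ C hle u hu T (by linarith)).trans ?_
  calc _ ≤ ENNReal.ofReal (4 * T ^ 2) + 2 * ENNReal.ofReal (K * T ^ 2)
        + 2 * ENNReal.ofReal (M * T ^ 2) := by
        gcongr
        · nlinarith
        · rw [← ENNReal.ofReal_toReal hMfin]
          apply ENNReal.ofReal_le_ofReal
          exact le_mul_of_one_le_right hM0 (one_le_pow₀ hT1)
    _ = _ := by
        rw [show (2 : ENNReal) = ENNReal.ofReal 2 by simp, ← ENNReal.ofReal_mul (by norm_num),
          ← ENNReal.ofReal_mul (by norm_num), ← ENNReal.ofReal_add (by positivity) (by positivity),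
          ← ENNReal.ofReal_add (by positivity) (by positivity)]
        congr 1; ring
end
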